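/- arXiv:2102.10328 — 2 statements merged into one kernel-verified Lean document; each statement's English description precedes it below -/
import Mathlib

section
/- For any permutations π and σ, D(π ⊕ σ) = D(π) ⊕ D(σ) and D(π ⊖ σ) = D(π) ⊖ D(σ). Equivalently: π ⊕ σ is (r,s)-coverable if and only if there exist s₁, s₂ with s₁+s₂ = s such that π is (r,s₁)-coverable and σ is (r,s₂)-coverable, and π ⊖ σ is (r,s)-coverable if and only if there exist r₁, r₂ with r₁+r₂ = r such that π is (r₁,s)-coverable and σ is (r₂,s)-coverable. -/
/-- The subsequence of `π` indexed by `S` is increasing. -/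
def IsIncOn {n : ℕ} (π : Equiv.Perm (Fin n)) (S : Set (Fin n)) : Prop :=
  ∀ i ∈ S, ∀ j ∈ S, i < j → π i < π j

/-- The subsequence of `π` indexed by `S` is decreasing. -/
def IsDecOn {n : ℕ} (π : Equiv.Perm (Fin n)) (S : Set (Fin n)) : Prop :=
  ∀ i ∈ S, ∀ j ∈ S, i < j → π j < π i

/-- `π` is `(r,s)`-coverable: its index set can be partitioned into `r` sets
indexing increasing subsequences and `s` sets indexing decreasing subsequences. -/
def Coverable {n : ℕ} (π : Equiv.Perm (Fin n)) (r s : ℕ) : Prop :=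
  ∃ c : Fin n → Fin r ⊕ Fin s,
    (∀ a : Fin r, IsIncOn π {i | c i = Sum.inl a}) ∧
    (∀ b : Fin s, IsDecOn π {i | c i = Sum.inr b})

/-- `π` is `k`-coverable: `(r,s)`-coverable for some `r + s = k`. -/
def KCoverable {n : ℕ} (π : Equiv.Perm (Fin n)) (k : ℕ) : Prop :=
  ∃ r s, r + s = k ∧ Coverable π r s

/-- `τ` is a pattern of `π`. -/
def Pattern {m n : ℕ} (τ : Equiv.Perm (Fin m)) (π : Equiv.Perm (Fin n)) : Prop :=
  ∃ f : Fin m → Fin n, StrictMono f ∧ ∀ i j, τ i < τ j ↔ π (f i) < π (f j)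

/-- `τ` is a proper pattern of `π`. -/
def ProperPattern {m n : ℕ} (τ : Equiv.Perm (Fin m)) (π : Equiv.Perm (Fin n)) : Prop :=
  m < n ∧ Pattern τ π

/-- `π` is `(r,s)`-critical. -/
def RSCritical {n : ℕ} (π : Equiv.Perm (Fin n)) (r s : ℕ) : Prop :=
  ¬ Coverable π r s ∧
    ∀ (m : ℕ) (τ : Equiv.Perm (Fin m)), ProperPattern τ π → Coverable τ r s

/-- `π` is `k`-critical. -/
def KCritical {n : ℕ} (π : Equiv.Perm (Fin n)) (k : ℕ) : Prop :=
  ¬ KCoverable π k ∧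
    ∀ (m : ℕ) (τ : Equiv.Perm (Fin m)), ProperPattern τ π → KCoverable τ k

/-- `π` is `(r,s)`-sharp: `(r,s)`-critical and `(0,s+1)`-coverable. -/
def RSSharp {n : ℕ} (π : Equiv.Perm (Fin n)) (r s : ℕ) : Prop :=
  RSCritical π r s ∧ Coverable π 0 (s + 1)

/-- `D(π)`: the set of pairs `(r,s)` such that `π` is not `(r,s)`-coverable. -/
def DSet {n : ℕ} (π : Equiv.Perm (Fin n)) : Set (ℕ × ℕ) :=
  {p | ¬ Coverable π p.1 p.2}

/-- A downset: a finite, downward-closed subset of `ℕ²`. -/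
def IsDownset (A : Set (ℕ × ℕ)) : Prop :=
  A.Finite ∧ ∀ p ∈ A, ∀ q : ℕ × ℕ, q.1 ≤ p.1 → q.2 ≤ p.2 → q ∈ A

/-- `A ⊕ B` for subsets of `ℕ²`. -/
def setOplus (A B : Set (ℕ × ℕ)) : Set (ℕ × ℕ) :=
  {p | ∀ s₁ s₂ : ℕ, s₁ + s₂ = p.2 → (p.1, s₁) ∈ A ∨ (p.1, s₂) ∈ B}

/-- `A ⊖ B` for subsets of `ℕ²`. -/
def setOminus (A B : Set (ℕ × ℕ)) : Set (ℕ × ℕ) :=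
  {p | ∀ r₁ r₂ : ℕ, r₁ + r₂ = p.1 → (r₁, p.2) ∈ A ∨ (r₂, p.2) ∈ B}

/-- `π` is `A`-coverable. -/
def ACoverable {n : ℕ} (π : Equiv.Perm (Fin n)) (A : Set (ℕ × ℕ)) : Prop :=
  ∃ p ∈ A, Coverable π p.1 p.2

/-- `π` is `A`-critical. -/
def ACritical {n : ℕ} (π : Equiv.Perm (Fin n)) (A : Set (ℕ × ℕ)) : Prop :=
  ¬ ACoverable π A ∧
    ∀ (m : ℕ) (τ : Equiv.Perm (Fin m)), ProperPattern τ π → ACoverable τ A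

/-- `π` is `A`-minimal: `A`-critical with `D(π) = A`. -/
def AMinimal {n : ℕ} (π : Equiv.Perm (Fin n)) (A : Set (ℕ × ℕ)) : Prop :=
  ACritical π A ∧ DSet π = A

/-- The triangle `T(k) = {(r,s) : r + s ≤ k}`. -/
def T (k : ℕ) : Set (ℕ × ℕ) := {p | p.1 + p.2 ≤ k}

/-- Direct sum of permutations: `π` followed by `σ` shifted up by `n`. -/
def directSum {n m : ℕ} (π : Equiv.Perm (Fin n)) (σ : Equiv.Perm (Fin m)) :
    Equiv.Perm (Fin (n + m)) :=
  finSumFinEquiv.symm.trans ((Equiv.sumCongr π σ).trans finSumFinEquiv)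

/-- Skew sum of permutations: `π` shifted up by `m`, followed by `σ`. -/
def skewSum {n m : ℕ} (π : Equiv.Perm (Fin n)) (σ : Equiv.Perm (Fin m)) :
    Equiv.Perm (Fin (n + m)) :=
  finSumFinEquiv.symm.trans (((Equiv.sumCongr π σ).trans
    (Equiv.sumComm (Fin n) (Fin m))).trans
    (finSumFinEquiv.trans (finCongr (Nat.add_comm m n))))

/-- Tensor product of permutations: `n` copies of `σ`, ordered like `π`. -/
def tensorProd {n m : ℕ} (π : Equiv.Perm (Fin n)) (σ : Equiv.Perm (Fin m)) :
    Equiv.Perm (Fin (n * m)) :=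
  finProdFinEquiv.symm.trans ((Equiv.prodCongr π σ).trans finProdFinEquiv)

theorem sum_map_id_eq_inl_iff {α β γ : Type*} {f : β → γ} {x : α ⊕ β} {a : α} :
    Sum.map id f x = Sum.inl a ↔ x = Sum.inl a := by
  cases x <;> simp

theorem sum_map_eq_inr_iff {α β γ δ : Type*} {g : α → δ} {f : β → γ} {x : α ⊕ β} {c : γ} :
    Sum.map g f x = Sum.inr c ↔ ∃ b, x = Sum.inr b ∧ f b = c := by
  cases x <;> simp

theorem castAdd_lt_natAdd {n m : ℕ} (i : Fin n) (j : Fin m) :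
    Fin.castAdd m i < Fin.natAdd n j := by
  simp only [Fin.lt_def, Fin.val_castAdd, Fin.val_natAdd]
  omega

/-- Only the decreasing colours that are actually used need to be counted. -/
theorem coverable_card_of_colours_mem {n r s : ℕ} {π : Equiv.Perm (Fin n)}
    (c : Fin n → Fin r ⊕ Fin s) (hinc : ∀ a, IsIncOn π {i | c i = Sum.inl a})
    (hdec : ∀ b, IsDecOn π {i | c i = Sum.inr b}) (P : Finset (Fin s))
    (hP : ∀ i b, c i = Sum.inr b → b ∈ P) : Coverable π r P.card := by
  have hlift : ∀ i, ∃ d : Fin r ⊕ Fin P.card,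
      Sum.map id (fun k => (P.equivFin.symm k : Fin s)) d = c i := by
    intro i
    rcases hc : c i with a | b
    · exact ⟨Sum.inl a, rfl⟩
    · exact ⟨Sum.inr (P.equivFin ⟨b, hP i b hc⟩), by simp⟩
  choose d hd using hlift
  have hinl : ∀ i a, d i = Sum.inl a → c i = Sum.inl a := by
    intro i a h
    simp [← hd i, h]
  have hinr : ∀ i b, d i = Sum.inr b → c i = Sum.inr (P.equivFin.symm b : Fin s) := by
    intro i b h
    simp [← hd i, h]
  exact ⟨d, fun a i hi j hj => hinc a i (hinl i a hi) j (hinl j a hj),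
    fun b i hi j hj => hdec _ i (hinr i b hi) j (hinr j b hj)⟩

theorem directSum_castAdd {n m : ℕ} (π : Equiv.Perm (Fin n)) (σ : Equiv.Perm (Fin m))
    (i : Fin n) : directSum π σ (Fin.castAdd m i) = Fin.castAdd m (π i) := by
  simp [directSum]

theorem directSum_natAdd {n m : ℕ} (π : Equiv.Perm (Fin n)) (σ : Equiv.Perm (Fin m))
    (j : Fin m) : directSum π σ (Fin.natAdd n j) = Fin.natAdd n (σ j) := by
  simp [directSum]

theorem Coverable.directSum {n m r s₁ s₂ : ℕ} {π : Equiv.Perm (Fin n)}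
    {σ : Equiv.Perm (Fin m)} (hπ : Coverable π r s₁) (hσ : Coverable σ r s₂) :
    Coverable (directSum π σ) r (s₁ + s₂) := by
  obtain ⟨c, hcinc, hcdec⟩ := hπ
  obtain ⟨d, hdinc, hddec⟩ := hσ
  refine ⟨Fin.addCases (fun i => Sum.map id (Fin.castAdd s₂) (c i))
    (fun j => Sum.map id (Fin.natAdd s₁) (d j)), fun a x hx y hy hxy => ?_,
    fun b x hx y hy hxy => ?_⟩
  · induction x using Fin.addCases <;> induction y using Fin.addCases <;>
      simp only [Set.mem_ofPred_eq, Fin.addCases_left, Fin.addCases_right,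
        directSum_castAdd, directSum_natAdd] at hx hy ⊢
    case left.left i j =>
      exact hcinc a i (sum_map_id_eq_inl_iff.1 hx) j
        (sum_map_id_eq_inl_iff.1 hy) hxy
    case left.right i j => exact castAdd_lt_natAdd _ _
    case right.left i j => exact absurd hxy (castAdd_lt_natAdd _ _).asymm
    case right.right i j =>
      exact (Fin.natAdd_lt_natAdd_iff _).2 <|
        hdinc a i (sum_map_id_eq_inl_iff.1 hx) j
          (sum_map_id_eq_inl_iff.1 hy) ((Fin.natAdd_lt_natAdd_iff _).1 hxy)
  · induction x using Fin.addCases <;> induction y using Fin.addCases <;>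
      simp only [Set.mem_ofPred_eq, Fin.addCases_left, Fin.addCases_right,
        directSum_castAdd, directSum_natAdd, sum_map_eq_inr_iff] at hx hy ⊢ <;>
      obtain ⟨k, hk, rfl⟩ := hx <;> obtain ⟨l, hl, hkl⟩ := hy
    case left.left i j =>
      obtain rfl : l = k := by simpa using hkl
      exact hcdec l i hk j hl hxy
    case left.right i j => exact absurd hkl (castAdd_lt_natAdd _ _).ne'
    case right.left i j => exact absurd hkl (castAdd_lt_natAdd _ _).ne
    case right.right i j =>
      obtain rfl : l = k := by simpa using hkl
      exact (Fin.natAdd_lt_natAdd_iff _).2 <|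
        hddec l i hk j hl ((Fin.natAdd_lt_natAdd_iff _).1 hxy)

/-- A decreasing subsequence of a direct sum lies entirely in one summand, so the decreasing
colours used on the left are unavailable on the right. -/
theorem Coverable.exists_of_directSum {n m r s : ℕ} {π : Equiv.Perm (Fin n)}
    {σ : Equiv.Perm (Fin m)} (h : Coverable (_root_.directSum π σ) r s) :
    ∃ s₁ s₂ : ℕ, s₁ + s₂ = s ∧ Coverable π r s₁ ∧ Coverable σ r s₂ := by
  classical
  obtain ⟨c, hinc, hdec⟩ := h
  let P : Finset (Fin s) := {b | ∃ i, c (Fin.castAdd m i) = Sum.inr b}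
  refine ⟨P.card, Pᶜ.card, by simp [Finset.card_add_card_compl],
    coverable_card_of_colours_mem (fun i => c (Fin.castAdd m i)) ?_ ?_ P ?_,
    coverable_card_of_colours_mem (fun j => c (Fin.natAdd n j)) ?_ ?_ Pᶜ ?_⟩
  · intro a i hi j hj hij
    have hlt := hinc a (Fin.castAdd m i) hi (Fin.castAdd m j) hj hij
    rwa [directSum_castAdd, directSum_castAdd] at hlt
  · intro b i hi j hj hij
    have hlt := hdec b (Fin.castAdd m i) hi (Fin.castAdd m j) hj hij
    rwa [directSum_castAdd, directSum_castAdd] at hlt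
  · intro i b hb
    simpa [P] using ⟨i, hb⟩
  · intro a i hi j hj hij
    simpa [directSum_natAdd] using
      hinc a (Fin.natAdd n i) hi (Fin.natAdd n j) hj ((Fin.natAdd_lt_natAdd_iff _).2 hij)
  · intro b i hi j hj hij
    simpa [directSum_natAdd] using
      hdec b (Fin.natAdd n i) hi (Fin.natAdd n j) hj ((Fin.natAdd_lt_natAdd_iff _).2 hij)
  · intro j b hj
    simp only [P, Finset.mem_compl, Finset.mem_filter_univ]
    rintro ⟨i, hi⟩
    have hlt := hdec b (Fin.castAdd m i) hi (Fin.natAdd n j) hj (castAdd_lt_natAdd _ _)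
    rw [directSum_castAdd, directSum_natAdd] at hlt
    exact hlt.asymm (castAdd_lt_natAdd _ _)

theorem coverable_directSum_iff {n m : ℕ} (π : Equiv.Perm (Fin n)) (σ : Equiv.Perm (Fin m))
    (r s : ℕ) : Coverable (directSum π σ) r s ↔
      ∃ s₁ s₂ : ℕ, s₁ + s₂ = s ∧ Coverable π r s₁ ∧ Coverable σ r s₂ := by
  refine ⟨Coverable.exists_of_directSum, ?_⟩
  rintro ⟨s₁, s₂, rfl, hπ, hσ⟩
  exact hπ.directSum hσ

/-- Complementing the values exchanges increasing and decreasing subsequences. -/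
theorem Coverable.trans_revPerm {n r s : ℕ} {π : Equiv.Perm (Fin n)} (h : Coverable π r s) :
    Coverable (π.trans Fin.revPerm) s r := by
  obtain ⟨c, hinc, hdec⟩ := h
  refine ⟨fun i => (c i).swap, fun a i hi j hj hij => ?_, fun b i hi j hj hij => ?_⟩
  · simpa using hdec a i (by simpa using congrArg Sum.swap hi) j
      (by simpa using congrArg Sum.swap hj) hij
  · simpa using hinc b i (by simpa using congrArg Sum.swap hi) j
      (by simpa using congrArg Sum.swap hj) hij

theorem coverable_trans_revPerm_iff {n r s : ℕ} (π : Equiv.Perm (Fin n)) :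
    Coverable (π.trans Fin.revPerm) s r ↔ Coverable π r s := by
  refine ⟨fun h => ?_, Coverable.trans_revPerm⟩
  have hrev : (π.trans Fin.revPerm).trans Fin.revPerm = π := by
    ext i
    simp
  simpa only [hrev] using h.trans_revPerm

theorem skewSum_trans_revPerm {n m : ℕ} (π : Equiv.Perm (Fin n)) (σ : Equiv.Perm (Fin m)) :
    (skewSum π σ).trans Fin.revPerm =
      directSum (π.trans Fin.revPerm) (σ.trans Fin.revPerm) := by
  ext x
  induction x using Fin.addCases with
  | left i =>
    rw [directSum_castAdd]
    simp [skewSum, Fin.val_rev]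
    omega
  | right j =>
    rw [directSum_natAdd]
    simp [skewSum, Fin.val_rev]
    omega

theorem coverable_skewSum_iff {n m : ℕ} (π : Equiv.Perm (Fin n)) (σ : Equiv.Perm (Fin m))
    (r s : ℕ) : Coverable (skewSum π σ) r s ↔
      ∃ r₁ r₂ : ℕ, r₁ + r₂ = r ∧ Coverable π r₁ s ∧ Coverable σ r₂ s := by
  rw [← coverable_trans_revPerm_iff, skewSum_trans_revPerm, coverable_directSum_iff]
  simp only [coverable_trans_revPerm_iff]

/-- Lemma 4: `D(π ⊕ σ) = D(π) ⊕ D(σ)` and `D(π ⊖ σ) = D(π) ⊖ D(σ)`; equivalently,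
coverings of a direct (resp. skew) sum split column-wise (resp. row-wise). -/
theorem DSet_sums {n m : ℕ} (π : Equiv.Perm (Fin n)) (σ : Equiv.Perm (Fin m)) :
    DSet (directSum π σ) = setOplus (DSet π) (DSet σ) ∧
    DSet (skewSum π σ) = setOminus (DSet π) (DSet σ) ∧
    (∀ r s : ℕ, Coverable (directSum π σ) r s ↔
      ∃ s₁ s₂ : ℕ, s₁ + s₂ = s ∧ Coverable π r s₁ ∧ Coverable σ r s₂) ∧
    (∀ r s : ℕ, Coverable (skewSum π σ) r s ↔
      ∃ r₁ r₂ : ℕ, r₁ + r₂ = r ∧ Coverable π r₁ s ∧ Coverable σ r₂ s) := by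
  refine ⟨?_, ?_, coverable_directSum_iff π σ, coverable_skewSum_iff π σ⟩
  · ext ⟨r, s⟩
    simp only [DSet, setOplus, Set.mem_ofPred_eq, coverable_directSum_iff, not_exists, not_and_or,
      imp_iff_not_or]
  · ext ⟨r, s⟩
    simp only [DSet, setOminus, Set.mem_ofPred_eq, coverable_skewSum_iff, not_exists, not_and_or,
      imp_iff_not_or]
end

section
/- Let k ∈ ℕ. If π is a T(k)-minimal permutation, then π ⊖ ι, where ι = 1 2 … (k+2) is the identity permutation of length k+2, is T(k+1)-minimal. -/
/-- The entries of `π` at positions in `S` can be covered by `r` increasing and `s` decreasing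
subsequences. -/
def CoverableOn {n : ℕ} (π : Equiv.Perm (Fin n)) (S : Set (Fin n)) (r s : ℕ) : Prop :=
  ∃ C : Fin r ⊕ Fin s → Set (Fin n), (∀ i ∈ S, ∃ e, i ∈ C e) ∧
    (∀ a : Fin r, IsIncOn π (C (Sum.inl a))) ∧ (∀ b : Fin s, IsDecOn π (C (Sum.inr b)))

theorem Coverable.coverableOn {n r s : ℕ} {π : Equiv.Perm (Fin n)} (h : Coverable π r s)
    (S : Set (Fin n)) : CoverableOn π S r s := by
  obtain ⟨c, h₁, h₂⟩ := h
  exact ⟨fun e => {i | c i = e}, fun i _ => ⟨c i, rfl⟩, h₁, h₂⟩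

theorem CoverableOn.coverable_of_pattern {m n r s : ℕ} {τ : Equiv.Perm (Fin m)}
    {π : Equiv.Perm (Fin n)} {S : Set (Fin n)} (h : CoverableOn π S r s) {f : Fin m → Fin n}
    (hf : StrictMono f) (hτ : ∀ i j, τ i < τ j ↔ π (f i) < π (f j)) (hS : ∀ i, f i ∈ S) :
    Coverable τ r s := by
  obtain ⟨C, hC, h₁, h₂⟩ := h
  choose c hc using fun i => hC (f i) (hS i)
  refine ⟨c, fun a i hi j hj hij => (hτ i j).2 (h₁ a _ ?_ _ ?_ (hf hij)),
    fun b i hi j hj hij => (hτ j i).2 (h₂ b _ ?_ _ ?_ (hf hij))⟩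
  · exact hi.out ▸ hc i
  · exact hj.out ▸ hc j
  · exact hi.out ▸ hc i
  · exact hj.out ▸ hc j

theorem CoverableOn.coverable_of_univ {n r s : ℕ} {π : Equiv.Perm (Fin n)}
    (h : CoverableOn π Set.univ r s) : Coverable π r s :=
  h.coverable_of_pattern strictMono_id (fun _ _ => Iff.rfl) fun _ => trivial

theorem coverableOn_zero_of_injOn {n s : ℕ} (π : Equiv.Perm (Fin n)) {S : Set (Fin n)}
    (g : Fin n → Fin s) (hg : Set.InjOn g S) : CoverableOn π S 0 s := by
  refine ⟨Sum.elim (fun a => a.elim0) fun b => {i | i ∈ S ∧ g i = b},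
    fun i hi => ⟨Sum.inr (g i), hi, rfl⟩, fun a => a.elim0, fun b i hi j hj hij => ?_⟩
  exact absurd (hg hi.1 hj.1 (hi.2.trans hj.2.symm)) hij.ne

theorem coverable_refl_one (n s : ℕ) : Coverable (Equiv.refl (Fin n)) 1 s :=
  ⟨fun _ => Sum.inl 0, fun _ _ _ _ _ hij => hij, fun _ _ hi => absurd hi Sum.inl_ne_inr⟩

theorem coverableOn_compl_singleton {m : ℕ} (π : Equiv.Perm (Fin (m + 2))) (x : Fin (m + 2)) :
    CoverableOn π {x}ᶜ 0 (m + 1) := by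
  refine coverableOn_zero_of_injOn π
    (fun y => if hy : y.val < m + 1 then ⟨y, hy⟩ else
      if hx : x.val < m + 1 then ⟨x, hx⟩ else 0) ?_
  intro y hy z hz hyz
  have hy' : y.val ≠ x.val := fun e => hy (Fin.ext e)
  have hz' : z.val ≠ x.val := fun e => hz (Fin.ext e)
  have hy₂ := y.isLt
  have hz₂ := z.isLt
  have hx₂ := x.isLt
  apply Fin.ext
  dsimp only at hyz
  split_ifs at hyz <;> simp only [Fin.ext_iff] at hyz <;> omega

/-- The pattern of `π` obtained by deleting the entry at position `x`. -/
def deletePerm {n : ℕ} (π : Equiv.Perm (Fin (n + 1))) (x : Fin (n + 1)) : Equiv.Perm (Fin n) :=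
  (finSuccAboveOrderIso x).toEquiv.trans
    ((π.subtypeEquiv (p := fun y => y ≠ x) (q := fun y => y ≠ π x) (by simp)).trans
      (finSuccAboveOrderIso (π x)).symm.toEquiv)

theorem deletePerm_lt_iff {n : ℕ} (π : Equiv.Perm (Fin (n + 1))) (x : Fin (n + 1)) (i j : Fin n) :
    deletePerm π x i < deletePerm π x j ↔ π (x.succAbove i) < π (x.succAbove j) :=
  (finSuccAboveOrderIso (π x)).symm.lt_iff_lt

theorem exists_coverableOn_compl_singleton {n : ℕ} {π : Equiv.Perm (Fin n)} {A : Set (ℕ × ℕ)}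
    (h : ACritical π A) (x : Fin n) : ∃ p ∈ A, CoverableOn π {x}ᶜ p.1 p.2 := by
  obtain _ | n := n
  · exact x.elim0
  obtain ⟨p, hp, c, h₁, h₂⟩ := h.2 n (deletePerm π x)
    ⟨n.lt_succ_self, x.succAbove, Fin.strictMono_succAbove x, deletePerm_lt_iff π x⟩
  refine ⟨p, hp, fun e => x.succAbove '' {i | c i = e}, fun i hi => ?_, fun a => ?_, fun b => ?_⟩
  · obtain ⟨z, rfl⟩ := Fin.exists_succAbove_eq hi
    exact ⟨c z, z, rfl, rfl⟩
  · rintro _ ⟨i, hi, rfl⟩ _ ⟨j, hj, rfl⟩ hij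
    exact (deletePerm_lt_iff π x i j).1
      (h₁ a i hi j hj ((Fin.strictMono_succAbove x).lt_iff_lt.1 hij))
  · rintro _ ⟨i, hi, rfl⟩ _ ⟨j, hj, rfl⟩ hij
    exact (deletePerm_lt_iff π x j i).1
      (h₂ b i hi j hj ((Fin.strictMono_succAbove x).lt_iff_lt.1 hij))

theorem skewSum_castAdd {n m : ℕ} (π : Equiv.Perm (Fin n)) (σ : Equiv.Perm (Fin m)) (i : Fin n) :
    (skewSum π σ (Fin.castAdd m i)).val = m + (π i).val := by
  simp [skewSum, add_comm]

theorem skewSum_natAdd {n m : ℕ} (π : Equiv.Perm (Fin n)) (σ : Equiv.Perm (Fin m)) (i : Fin m) :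
    (skewSum π σ (Fin.natAdd n i)).val = (σ i).val := by
  simp [skewSum]

theorem skewSum_castAdd_lt_iff {n m : ℕ} (π : Equiv.Perm (Fin n)) (σ : Equiv.Perm (Fin m))
    (i j : Fin n) :
    skewSum π σ (Fin.castAdd m i) < skewSum π σ (Fin.castAdd m j) ↔ π i < π j := by
  simp only [Fin.lt_def, skewSum_castAdd, add_lt_add_iff_left]

theorem skewSum_natAdd_lt_iff {n m : ℕ} (π : Equiv.Perm (Fin n)) (σ : Equiv.Perm (Fin m))
    (i j : Fin m) :
    skewSum π σ (Fin.natAdd n i) < skewSum π σ (Fin.natAdd n j) ↔ σ i < σ j := by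
  simp only [Fin.lt_def, skewSum_natAdd]

theorem skewSum_natAdd_lt_castAdd {n m : ℕ} (π : Equiv.Perm (Fin n)) (σ : Equiv.Perm (Fin m))
    (i : Fin n) (j : Fin m) :
    skewSum π σ (Fin.natAdd n j) < skewSum π σ (Fin.castAdd m i) := by
  rw [Fin.lt_def, skewSum_natAdd, skewSum_castAdd]
  omega

theorem CoverableOn.skewSum {n m r₁ r₂ s : ℕ} {π : Equiv.Perm (Fin n)} {σ : Equiv.Perm (Fin m)}
    {U : Set (Fin (n + m))} (hπ : CoverableOn π (Fin.castAdd m ⁻¹' U) r₁ s)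
    (hσ : CoverableOn σ (Fin.natAdd n ⁻¹' U) r₂ s) :
    CoverableOn (skewSum π σ) U (r₁ + r₂) s := by
  obtain ⟨C, hC, C₁, C₂⟩ := hπ
  obtain ⟨D, hD, D₁, D₂⟩ := hσ
  refine ⟨Sum.elim
    (Fin.addCases (fun a => Fin.castAdd m '' C (Sum.inl a)) fun a => Fin.natAdd n '' D (Sum.inl a))
    (fun b => Fin.castAdd m '' C (Sum.inr b) ∪ Fin.natAdd n '' D (Sum.inr b)),
    fun i hi => ?_, fun a => ?_, fun b => ?_⟩
  · induction i using Fin.addCases with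
    | left i =>
      obtain ⟨a | b, he⟩ := hC i hi
      · exact ⟨Sum.inl (Fin.castAdd r₂ a), by simpa using he⟩
      · exact ⟨Sum.inr b, Or.inl ⟨i, he, rfl⟩⟩
    | right i =>
      obtain ⟨a | b, he⟩ := hD i hi
      · exact ⟨Sum.inl (Fin.natAdd r₁ a), by simpa using he⟩
      · exact ⟨Sum.inr b, Or.inr ⟨i, he, rfl⟩⟩
  · induction a using Fin.addCases with
    | left a =>
      simp only [Sum.elim_inl, Fin.addCases_left]
      rintro _ ⟨i, hi, rfl⟩ _ ⟨j, hj, rfl⟩ hij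
      exact (skewSum_castAdd_lt_iff π σ i j).2 (C₁ a i hi j hj hij)
    | right a =>
      simp only [Sum.elim_inl, Fin.addCases_right]
      rintro _ ⟨i, hi, rfl⟩ _ ⟨j, hj, rfl⟩ hij
      exact (skewSum_natAdd_lt_iff π σ i j).2 (D₁ a i hi j hj (by simpa using hij))
  · rintro _ (⟨i, hi, rfl⟩ | ⟨i, hi, rfl⟩) _ (⟨j, hj, rfl⟩ | ⟨j, hj, rfl⟩) hij
    · exact (skewSum_castAdd_lt_iff π σ j i).2 (C₂ b i hi j hj hij)
    · exact skewSum_natAdd_lt_castAdd π σ i j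
    · rw [Fin.lt_def, Fin.val_natAdd, Fin.val_castAdd] at hij
      omega
    · exact (skewSum_natAdd_lt_iff π σ j i).2 (D₂ b i hi j hj (by simpa using hij))

/-- A covering of `π ⊖ (1 2 … m)` by fewer than `m` subsequences restricts to a covering of `π`
using one increasing subsequence less. -/
theorem exists_coverable_of_coverable_skewSum_refl {n m r s : ℕ} {π : Equiv.Perm (Fin n)}
    (hm : r + s < m) (h : Coverable (skewSum π (Equiv.refl (Fin m))) r s) :
    ∃ r', r' + 1 = r ∧ Coverable π r' s := by
  obtain ⟨c, h₁, h₂⟩ := h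
  obtain ⟨i, j, hij, hc⟩ : ∃ i j : Fin m, i < j ∧ c (Fin.natAdd n i) = c (Fin.natAdd n j) := by
    obtain ⟨i, j, hne, hc⟩ := Fintype.exists_ne_map_eq_of_card_lt
      (fun i : Fin m => c (Fin.natAdd n i)) (by simpa using hm)
    rcases hne.lt_or_gt with h | h
    · exact ⟨i, j, h, hc⟩
    · exact ⟨j, i, h, hc.symm⟩
  have hij' : Fin.natAdd n i < Fin.natAdd n j := by simpa using hij
  rcases ha : c (Fin.natAdd n i) with a | b
  · obtain _ | r := r
    · exact a.elim0
    have hne : ∀ l : Fin n, c (Fin.castAdd m l) ≠ Sum.inl a := fun l hl => by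
      refine lt_asymm (skewSum_natAdd_lt_castAdd π _ l i) (h₁ a _ hl _ ha ?_)
      rw [Fin.lt_def, Fin.val_natAdd, Fin.val_castAdd]
      omega
    have hd : ∀ l : Fin n, ∃ d : Fin r ⊕ Fin s,
        Sum.map a.succAbove id d = c (Fin.castAdd m l) := fun l => by
      rcases hl : c (Fin.castAdd m l) with e | b
      · obtain ⟨z, hz⟩ := Fin.exists_succAbove_eq (fun e' => hne l (e' ▸ hl) : e ≠ a)
        exact ⟨Sum.inl z, by simp [hz]⟩
      · exact ⟨Sum.inr b, rfl⟩
    choose d hd using hd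
    refine ⟨r, rfl, d, fun e p hp q hq hpq => ?_, fun b p hp q hq hpq => ?_⟩
    · exact (skewSum_castAdd_lt_iff π _ p q).1 <| h₁ (a.succAbove e) (Fin.castAdd m p) (by simp [← hd, hp.out])
        (Fin.castAdd m q) (by simp [← hd, hq.out]) hpq
    · exact (skewSum_castAdd_lt_iff π _ q p).1 <| h₂ b (Fin.castAdd m p) (by simp [← hd, hp.out])
        (Fin.castAdd m q) (by simp [← hd, hq.out]) hpq
  · exact absurd ((skewSum_natAdd_lt_iff π _ j i).1 (h₂ b _ ha _ (hc.symm.trans ha) hij'))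
      hij.not_gt

/-- If `π` is `T(k)`-minimal then `π ⊖ (1 2 … (k+2))` is `T(k+1)`-minimal. -/
theorem Tminimal_skew_id {n : ℕ} (k : ℕ) (π : Equiv.Perm (Fin n))
    (h : AMinimal π (T k)) :
    AMinimal (skewSum π (Equiv.refl (Fin (k + 2)))) (T (k + 1)) := by
  obtain ⟨hcrit, hD⟩ := h
  have hπ : ∀ r s, Coverable π r s ↔ k < r + s := fun r s => by
    have : (r, s) ∈ DSet π ↔ (r, s) ∈ T k := by rw [hD]
    simp only [DSet, T, Set.mem_ofPred_eq] at this
    rw [← not_le, ← this, not_not]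
  have hσ : ∀ r s, Coverable (skewSum π (Equiv.refl (Fin (k + 2)))) r s ↔ k + 1 < r + s := by
    refine fun r s => ⟨fun hc => ?_, fun hrs => CoverableOn.coverable_of_univ ?_⟩
    · by_contra hlt
      obtain ⟨r', rfl, hr'⟩ := exists_coverable_of_coverable_skewSum_refl (by omega) hc
      have := (hπ r' s).1 hr'
      omega
    · obtain _ | r := r
      · exact CoverableOn.skewSum (r₁ := 0) (r₂ := 0)
          (((hπ 0 s).2 (by omega)).coverableOn _)
          (coverableOn_zero_of_injOn _ (Fin.castLE (by omega)) (Fin.castLE_injective _).injOn)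
      · exact CoverableOn.skewSum (((hπ r s).2 (by omega)).coverableOn _)
          ((coverable_refl_one _ s).coverableOn _)
  refine ⟨⟨?_, ?_⟩, ?_⟩
  · rintro ⟨p, hp, hc⟩
    exact absurd ((hσ _ _).1 hc) (not_lt.2 hp)
  · rintro m τ ⟨hm, f, hf, hτ⟩
    obtain ⟨x, hx⟩ : ∃ x, ∀ i, f i ≠ x := by
      by_contra! hsurj
      have := Fintype.card_le_of_surjective f hsurj
      simp only [Fintype.card_fin] at this
      omega
    suffices ∃ p ∈ T (k + 1),
        CoverableOn (skewSum π (Equiv.refl (Fin (k + 2)))) {x}ᶜ p.1 p.2 by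
      obtain ⟨p, hp, hc⟩ := this
      exact ⟨p, hp, hc.coverable_of_pattern hf hτ hx⟩
    induction x using Fin.addCases with
    | left x =>
      obtain ⟨⟨r, s⟩, hp, hc⟩ := exists_coverableOn_compl_singleton hcrit x
      refine ⟨(r + 1, s), ?_, CoverableOn.skewSum ?_ ((coverable_refl_one _ s).coverableOn _)⟩
      · simp only [T, Set.mem_ofPred_eq] at hp ⊢
        omega
      · convert hc using 1
        ext y
        simp
    | right x =>
      refine ⟨(0, k + 1), by simp [T], CoverableOn.skewSum (r₁ := 0) (r₂ := 0)
        (((hπ 0 (k + 1)).2 (by omega)).coverableOn _) ?_⟩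
      convert coverableOn_compl_singleton (Equiv.refl (Fin (k + 2))) x using 1
      ext y
      simp
  · ext ⟨r, s⟩
    simp only [DSet, T, Set.mem_ofPred_eq, hσ, not_lt]
end
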